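/- There exists an oracle A ⊆ ℕ of hyperimmune-free degree such that A is weakly Schnorr engulfing and A computes a Schnorr random element of Cantor space 2^ω. -/

import Mathlib

open Filter

namespace CichonAnalog

/-! ### Oracle computability -/

/-- Partial functions `ℕ →. ℕ` partial recursive relative to the oracle `A ⊆ ℕ`.
This is Mathlib's `Nat.Partrec` with an extra base case for the characteristic
function of the oracle. -/
inductive RecursiveIn (A : Set ℕ) : (ℕ →. ℕ) → Prop
  | zero : RecursiveIn A (pure 0)
  | succ : RecursiveIn A ↑Nat.succ
  | left : RecursiveIn A ↑fun n : ℕ => n.unpair.1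
  | right : RecursiveIn A ↑fun n : ℕ => n.unpair.2
  | oracle : RecursiveIn A ↑fun n : ℕ => A.indicator (fun _ => 1) n
  | pair {f g} : RecursiveIn A f → RecursiveIn A g →
      RecursiveIn A fun n => Nat.pair <$> f n <*> g n
  | comp {f g} : RecursiveIn A f → RecursiveIn A g →
      RecursiveIn A fun n => g n >>= f
  | prec {f g} : RecursiveIn A f → RecursiveIn A g →
      RecursiveIn A (Nat.unpaired fun a n =>
        n.rec (f a) fun y IH => do let i ← IH; g (Nat.pair a (Nat.pair y i)))
  | rfind {f} : RecursiveIn A f →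
      RecursiveIn A fun a => Nat.rfind fun n => (fun m => m = 0) <$> f (Nat.pair a n)

/-- The partial function `f` (between coded spaces) is partial recursive in the oracle `A`. -/
def PartrecIn (A : Set ℕ) {α σ : Type} [Primcodable α] [Primcodable σ] (f : α →. σ) : Prop :=
  RecursiveIn A fun n =>
    Part.bind ↑(Encodable.decode (α := α) n) fun a => (f a).map Encodable.encode

/-- `f ≤_T A` : the (total) function `f` is computable from the oracle `A`. -/
def ComputableIn (A : Set ℕ) {α σ : Type} [Primcodable α] [Primcodable σ] (f : α → σ) : Prop :=
  PartrecIn A (f : α →. σ)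

/-- `W` is computably enumerable in the oracle `A`. -/
def CEIn (A : Set ℕ) {α : Type} [Primcodable α] (W : Set α) : Prop :=
  ∃ f : α →. ℕ, PartrecIn A f ∧ ∀ a, a ∈ W ↔ (f a).Dom

/-- `W` is computably enumerable (unrelativized). -/
def CE {α : Type} [Primcodable α] (W : Set α) : Prop :=
  ∃ f : α →. ℕ, Partrec f ∧ ∀ a, a ∈ W ↔ (f a).Dom

/-! ### Cantor space, `Π⁰₁` classes, effective meagerness -/

/-- The basic clopen set (cylinder) of the finite binary string `σ` in Cantor space. -/
def Cyl (σ : List Bool) : Set (ℕ → Bool) :=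
  {x | ∀ i, i < σ.length → x i = σ.getD i false}

/-- `P` is a `Π⁰₁(A)` class: a closed subset of Cantor space whose complement is the
union of basic clopen sets over a set of strings c.e. in `A`. -/
def Pi01In (A : Set ℕ) (P : Set (ℕ → Bool)) : Prop :=
  ∃ W : Set (List Bool), CEIn A W ∧ P = (⋃ σ ∈ W, Cyl σ)ᶜ

/-- `P` is a (plain) `Π⁰₁` class. -/
def Pi01 (P : Set (ℕ → Bool)) : Prop :=
  ∃ W : Set (List Bool), CE W ∧ P = (⋃ σ ∈ W, Cyl σ)ᶜ

/-- `C` is a uniformly `Π⁰₁(A)` sequence of classes. -/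
def UnifPi01In (A : Set ℕ) (C : ℕ → Set (ℕ → Bool)) : Prop :=
  ∃ W : Set (ℕ × List Bool), CEIn A W ∧
    ∀ m, C m = (⋃ σ ∈ {s | (m, s) ∈ W}, Cyl σ)ᶜ

/-- `C` is a uniformly `Π⁰₁` sequence of classes. -/
def UnifPi01 (C : ℕ → Set (ℕ → Bool)) : Prop :=
  ∃ W : Set (ℕ × List Bool), CE W ∧
    ∀ m, C m = (⋃ σ ∈ {s | (m, s) ∈ W}, Cyl σ)ᶜ

/-- `S` is effectively meager relative to `A`: it is contained in the union of a
uniformly `Π⁰₁(A)` sequence of nowhere dense classes. -/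
def EffMeagerIn (A : Set ℕ) (S : Set (ℕ → Bool)) : Prop :=
  ∃ C : ℕ → Set (ℕ → Bool), UnifPi01In A C ∧ (∀ m, IsNowhereDense (C m)) ∧ S ⊆ ⋃ m, C m

/-- `S` is effectively meager (unrelativized). -/
def EffMeager (S : Set (ℕ → Bool)) : Prop :=
  ∃ C : ℕ → Set (ℕ → Bool), UnifPi01 C ∧ (∀ m, IsNowhereDense (C m)) ∧ S ⊆ ⋃ m, C m

/-- `A` is meager engulfing: some `A`-effectively meager set contains every
effectively meager set. -/
def MeagerEngulfing (A : Set ℕ) : Prop :=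
  ∃ S, EffMeagerIn A S ∧ ∀ T, EffMeager T → T ⊆ S

/-- `A` is weakly meager engulfing: some `A`-effectively meager set contains every
computable element of Cantor space. -/
def WeaklyMeagerEngulfing (A : Set ℕ) : Prop :=
  ∃ S, EffMeagerIn A S ∧ ∀ x : ℕ → Bool, Computable x → x ∈ S

/-- `V` is a computable set of finite binary strings. -/
def ComputableStringSet (V : Set (List Bool)) : Prop :=
  ∃ χ : List Bool → Bool, Computable χ ∧ ∀ s, s ∈ V ↔ χ s = true

/-- `V` is a dense set of finite binary strings: every string has an extension in `V`. -/
def DenseStringSet (V : Set (List Bool)) : Prop :=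
  ∀ σ : List Bool, ∃ τ ∈ V, σ <+: τ

/-- `x ∈ 2^ω` is weakly 1-generic: for every computable dense set `V` of finite
binary strings, some initial segment of `x` lies in `V`. -/
def Weakly1Generic (x : ℕ → Bool) : Prop :=
  ∀ V : Set (List Bool), ComputableStringSet V → DenseStringSet V →
    ∃ n, (List.ofFn fun i : Fin n => x i) ∈ V

/-! ### Domination properties -/

/-- `A` is high: `A` computes a function dominating every total computable function. -/
def High (A : Set ℕ) : Prop :=
  ∃ f : ℕ → ℕ, ComputableIn A f ∧
    ∀ g : ℕ → ℕ, Computable g → ∀ᶠ n in atTop, g n ≤ f n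

/-- `A` is of hyperimmune degree: `A` computes a function not dominated by any
computable function. -/
def HyperimmuneDegree (A : Set ℕ) : Prop :=
  ∃ f : ℕ → ℕ, ComputableIn A f ∧
    ∀ g : ℕ → ℕ, Computable g → ∃ᶠ n in atTop, g n < f n

/-- `A` is of hyperimmune-free degree: every function computable in `A` is dominated
by a total computable function. -/
def HyperimmuneFree (A : Set ℕ) : Prop :=
  ∀ f : ℕ → ℕ, ComputableIn A f →
    ∃ g : ℕ → ℕ, Computable g ∧ ∀ᶠ n in atTop, f n ≤ g n

/-! ### Measure on Cantor space, Kurtz and Schnorr tests -/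

open scoped Classical in
/-- The uniform measure of the clopen set `⋃ σ ∈ F, [σ]` determined by the finite
list `F` of binary strings: count the binary strings of maximal length extending
some member of `F`, and normalize. -/
noncomputable def listMeasure (F : List (List Bool)) : ℚ :=
  letI k := (F.map List.length).foldr max 0
  ((Finset.univ.filter fun v : Fin k → Bool =>
      ∃ σ ∈ F, σ <+: List.ofFn v).card : ℚ) / 2 ^ k

/-- The clopen subset of Cantor space given explicitly as a finite union of
basic clopen sets. -/
def ClopSet (F : List (List Bool)) : Set (ℕ → Bool) := ⋃ σ ∈ F, Cyl σ

/-- The effectively open subset of Cantor space enumerated by the sequence of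
finite stages `g`. -/
def OpenSet (g : ℕ → List (List Bool)) : Set (ℕ → Bool) := ⋃ s, ClopSet (g s)

/-- The measure of the open set enumerated by the stages `g`: the supremum of the
measures of its finite partial unions. -/
noncomputable def openMeasure (g : ℕ → List (List Bool)) : ℝ :=
  ⨆ s : ℕ, (listMeasure ((List.range (s + 1)).flatMap g) : ℝ)

/-- A Kurtz test relative to `A`: an `A`-computable sequence of explicitly given
clopen sets, the `m`-th of measure at most `2 ^ (-m)`. -/
def KurtzTestIn (A : Set ℕ) (G : ℕ → List (List Bool)) : Prop :=
  ComputableIn A G ∧ ∀ m, listMeasure (G m) ≤ (1 / 2) ^ m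

/-- A (plain) Kurtz test. -/
def KurtzTest (G : ℕ → List (List Bool)) : Prop :=
  Computable G ∧ ∀ m, listMeasure (G m) ≤ (1 / 2) ^ m

/-- A Schnorr test relative to `A`: an `A`-computable doubly indexed sequence of finite
stages such that the `m`-th effectively open set `⋃ s, ClopSet (g m s)` has measure at
most `2 ^ (-m)`, and this measure is a real computable in `A` uniformly in `m`. -/
def SchnorrTestIn (A : Set ℕ) (g : ℕ → ℕ → List (List Bool)) : Prop :=
  ComputableIn A (fun p : ℕ × ℕ => g p.1 p.2) ∧
  (∀ m, openMeasure (g m) ≤ (1 / 2) ^ m) ∧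
  ∃ q : ℕ × ℕ → ℚ, ComputableIn A q ∧
    ∀ m k, |openMeasure (g m) - (q (m, k) : ℝ)| ≤ (1 / 2) ^ k

/-- A (plain) Schnorr test. -/
def SchnorrTest (g : ℕ → ℕ → List (List Bool)) : Prop :=
  Computable (fun p : ℕ × ℕ => g p.1 p.2) ∧
  (∀ m, openMeasure (g m) ≤ (1 / 2) ^ m) ∧
  ∃ q : ℕ × ℕ → ℚ, Computable q ∧
    ∀ m k, |openMeasure (g m) - (q (m, k) : ℝ)| ≤ (1 / 2) ^ k

/-- `N` is Schnorr null relative to `A`. -/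
def SchnorrNullIn (A : Set ℕ) (N : Set (ℕ → Bool)) : Prop :=
  ∃ g, SchnorrTestIn A g ∧ N ⊆ ⋂ m, OpenSet (g m)

/-- `N` is Schnorr null (unrelativized). -/
def SchnorrNull (N : Set (ℕ → Bool)) : Prop :=
  ∃ g, SchnorrTest g ∧ N ⊆ ⋂ m, OpenSet (g m)

/-- `x ∈ 2^ω` is Schnorr random: it belongs to no Schnorr null set. -/
def SchnorrRandom (x : ℕ → Bool) : Prop := ∀ N, SchnorrNull N → x ∉ N

/-- `A` is Kurtz engulfing: there is an `A`-computable sequence of Kurtz tests relative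
to `A` such that every Kurtz null set is contained in the null set of one of them. -/
def KurtzEngulfing (A : Set ℕ) : Prop :=
  ∃ G : ℕ → ℕ → List (List Bool),
    ComputableIn A (fun p : ℕ × ℕ => G p.1 p.2) ∧
    (∀ i m, listMeasure (G i m) ≤ (1 / 2) ^ m) ∧
    ∀ L, KurtzTest L → ∃ i, (⋂ m, ClopSet (L m)) ⊆ ⋂ m, ClopSet (G i m)

/-- `A` is weakly Kurtz engulfing: there is an `A`-computable sequence of Kurtz tests
relative to `A` such that the union of their null sets contains every computable
element of Cantor space. -/
def WeaklyKurtzEngulfing (A : Set ℕ) : Prop :=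
  ∃ G : ℕ → ℕ → List (List Bool),
    ComputableIn A (fun p : ℕ × ℕ => G p.1 p.2) ∧
    (∀ i m, listMeasure (G i m) ≤ (1 / 2) ^ m) ∧
    ∀ x : ℕ → Bool, Computable x → ∃ i, x ∈ ⋂ m, ClopSet (G i m)

/-- `A` is weakly Schnorr engulfing: some set Schnorr null relative to `A` contains
every computable element of Cantor space. -/
def WeaklySchnorrEngulfing (A : Set ℕ) : Prop :=
  ∃ N, SchnorrNullIn A N ∧ ∀ x : ℕ → Bool, Computable x → x ∈ N

/-! ### DNR and PA degrees -/

/-- The `e`-th partial computable function. -/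
noncomputable def phi (e : ℕ) : ℕ →. ℕ := (Denumerable.ofNat Nat.Partrec.Code e).eval

/-- `h` is diagonally nonrecursive. -/
def DNRFun (h : ℕ → ℕ) : Prop := ∀ e, ∀ y ∈ phi e e, h e ≠ y

/-- `A` is DNR: `A` computes a diagonally nonrecursive function. -/
def DNRDegree (A : Set ℕ) : Prop := ∃ h : ℕ → ℕ, ComputableIn A h ∧ DNRFun h

/-- `A` is PA: `A` computes a `{0,1}`-valued diagonally nonrecursive function. -/
def PA (A : Set ℕ) : Prop :=
  ∃ h : ℕ → ℕ, ComputableIn A h ∧ (∀ e, h e ≤ 1) ∧ DNRFun h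

/-! ### Traces -/

/-- The trace `σ` (satisfying `|σ n| ≤ n`) traces the function `f` if
`f n ∈ σ n` for all but finitely many `n`. -/
def Traces (σ : ℕ → Finset ℕ) (f : ℕ → ℕ) : Prop := ∀ᶠ n in atTop, f n ∈ σ n

/-- `σ` is a `(D, g)`-trace relative to `A`: `D` is infinite and c.e. in `A`, `g` is a
partial `A`-computable function with `D ⊆ dom g` and `g n ≥ n` on its domain, and `σ`
is partial `A`-computable, defined on `D`, with `|σ n| < g n` for all `n ∈ D`. -/
def IsDGTraceIn (A : Set ℕ) (D : Set ℕ) (g : ℕ →. ℕ) (σ : ℕ →. Finset ℕ) : Prop :=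
  D.Infinite ∧ CEIn A D ∧ PartrecIn A g ∧ D ⊆ g.Dom ∧ (∀ n, ∀ y ∈ g n, n ≤ y) ∧
  PartrecIn A σ ∧ D ⊆ σ.Dom ∧ ∀ n ∈ D, ∀ S ∈ σ n, ∀ b ∈ g n, S.card < b

/-- `σ` is a `(D, g)`-trace (unrelativized). -/
def IsDGTrace (D : Set ℕ) (g : ℕ →. ℕ) (σ : ℕ →. Finset ℕ) : Prop :=
  D.Infinite ∧ CE D ∧ Partrec g ∧ D ⊆ g.Dom ∧ (∀ n, ∀ y ∈ g n, n ≤ y) ∧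
  Partrec σ ∧ D ⊆ σ.Dom ∧ ∀ n ∈ D, ∀ S ∈ σ n, ∀ b ∈ g n, S.card < b

/-- The `(D, g)`-trace `σ` traces `f`: `f n ∈ σ n` for all but finitely many `n ∈ D`. -/
def DGTraces (D : Set ℕ) (σ : ℕ →. Finset ℕ) (f : ℕ → ℕ) : Prop :=
  ∀ᶠ n in atTop, n ∈ D → ∀ S ∈ σ n, f n ∈ S

section

open MeasureTheory Nat.Partrec.Code

/-- `n` codes a reduced fraction. -/
def IsRatCode (n : ℕ) : Prop :=
  0 < n.unpair.2 ∧ ∀ k < n.unpair.2 + 1, k ≤ 1 ∨ n.unpair.2 % k ≠ 0 ∨ (n.unpair.1 + 1) / 2 % k ≠ 0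

instance : DecidablePred IsRatCode := fun n => by unfold IsRatCode; infer_instance

theorem primrecPred_isRatCode : PrimrecPred IsRatCode := by
  have h1 : Primrec fun n : ℕ => n.unpair.1 := Primrec.fst.comp Primrec.unpair
  have h2 : Primrec fun n : ℕ => n.unpair.2 := Primrec.snd.comp Primrec.unpair
  refine PrimrecPred.and (Primrec.nat_lt.comp (Primrec.const 0) h2) ?_
  have hR : PrimrecRel fun (k n : ℕ) =>
      k ≤ 1 ∨ n.unpair.2 % k ≠ 0 ∨ (n.unpair.1 + 1) / 2 % k ≠ 0 := by
    have g1 : Primrec fun p : ℕ × ℕ => p.2.unpair.2 % p.1 :=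
      Primrec.nat_mod.comp (h2.comp Primrec.snd) Primrec.fst
    have g2 : Primrec fun p : ℕ × ℕ => (p.2.unpair.1 + 1) / 2 % p.1 :=
      Primrec.nat_mod.comp (Primrec.nat_div.comp
        (Primrec.succ.comp (h1.comp Primrec.snd)) (Primrec.const 2)) Primrec.fst
    exact PrimrecPred.primrecRel (p := fun p : ℕ × ℕ => p.1 ≤ 1 ∨ p.2.unpair.2 % p.1 ≠ 0 ∨
        (p.2.unpair.1 + 1) / 2 % p.1 ≠ 0)
      (PrimrecPred.or (Primrec.nat_le.comp Primrec.fst (Primrec.const 1))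
      (PrimrecPred.or (PrimrecPred.not (Primrec.eq.comp g1 (Primrec.const 0)))
        (PrimrecPred.not (Primrec.eq.comp g2 (Primrec.const 0)))))
  exact (hR.forall_lt.comp (Primrec.succ.comp h2) Primrec.id)

theorem natAbs_intEquivNat_symm (n : ℕ) : (Equiv.intEquivNat.symm n).natAbs = (n + 1) / 2 := by
  obtain ⟨z, rfl⟩ := Equiv.intEquivNat.surjective n
  rw [Equiv.symm_apply_apply]
  cases z with
  | ofNat k =>
    change k = (2 * k + 1) / 2
    lia
  | negSucc k =>
    change k + 1 = (2 * k + 1 + 1) / 2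
    lia

theorem isRatCode_iff (n : ℕ) :
    IsRatCode n ↔ n ∈ Set.range (@Encodable.encode ℚ Rat.instEncodable) := by
  have key : IsRatCode n ↔ 0 < n.unpair.2 ∧ ((n.unpair.1 + 1) / 2).Coprime n.unpair.2 := by
    refine and_congr_right fun hd => ⟨fun h => Nat.coprime_of_dvd' fun k hk h1 h2 => ?_, ?_⟩
    · rcases h k (Nat.lt_succ_of_le (Nat.le_of_dvd hd h2)) with h | h | h
      · exact absurd hk.two_le (by lia)
      · exact absurd (Nat.mod_eq_zero_of_dvd h2) h
      · exact absurd (Nat.mod_eq_zero_of_dvd h1) h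
    · intro h k hk
      by_contra! hc
      have := Nat.dvd_gcd (Nat.dvd_of_mod_eq_zero hc.2.2) (Nat.dvd_of_mod_eq_zero hc.2.1)
      rw [h] at this
      exact absurd (Nat.le_of_dvd one_pos this) (by lia)
  rw [key, ← natAbs_intEquivNat_symm]
  constructor
  · rintro ⟨h1, h2⟩
    refine ⟨⟨Equiv.intEquivNat.symm n.unpair.1, n.unpair.2, h1.ne', h2⟩, ?_⟩
    change Nat.pair (Equiv.intEquivNat (Equiv.intEquivNat.symm n.unpair.1)) n.unpair.2 = n
    simp
  · rintro ⟨r, rfl⟩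
    change 0 < (Nat.unpair (Nat.pair (Equiv.intEquivNat r.num) r.den)).2 ∧ _
    change _ ∧ (Equiv.intEquivNat.symm (Nat.unpair (Nat.pair
        (Equiv.intEquivNat r.num) r.den)).1).natAbs.Coprime (Nat.unpair (Nat.pair
            (Equiv.intEquivNat r.num) r.den)).2
    simpa [r.pos] using r.reduced

theorem encode_rat_eq_length (r : ℚ) :
    @Encodable.encode ℚ Primcodable.toEncodable r =
      ((List.range (Nat.pair (Encodable.encode r.num) r.den)).filter
        (fun n => decide (IsRatCode n))).length := by
  have : IsRatCode = fun n => n ∈ Set.range (@Encodable.encode ℚ Rat.instEncodable) := by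
    funext n; exact propext (isRatCode_iff n)
  rw [← List.countP_eq_length_filter]
  let _ := @Encodable.decidableRangeEncode ℚ Rat.instEncodable
  trans ((List.range (@Encodable.encode ℚ Rat.instEncodable r)).countP
    (fun n => decide (n ∈ Set.range (@Encodable.encode ℚ Rat.instEncodable))))
  · rfl
  · congr! 3 with n
    exact (isRatCode_iff n).symm

theorem primrec_nat_pow : Primrec₂ ((· ^ ·) : ℕ → ℕ → ℕ) :=
  Primrec₂.unpaired'.1 Nat.Primrec.pow

/-- The rational `(2c+1)/2^(k+1)`, which is in lowest terms. -/
def oddDyadic (c k : ℕ) : ℚ := (2 * c + 1 : ℕ) / (2 ^ (k + 1) : ℕ)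

theorem primrec_oddDyadic : Primrec₂ oddDyadic := by
  have key : ∀ p : ℕ × ℕ, @Encodable.encode ℚ Primcodable.toEncodable (oddDyadic p.1 p.2) =
      ((List.range (Nat.pair (2 * (2 * p.1 + 1)) (2 ^ (p.2 + 1)))).filter
        (fun n => decide (IsRatCode n))).length := by
    rintro ⟨c, k⟩
    have hnum : (oddDyadic c k).num = (2 * c + 1 : ℕ) := by
      have := Rat.num_div_eq_of_coprime (a := (2 * c + 1 : ℕ)) (b := (2 ^ (k + 1) : ℕ))
          (by positivity) (by simp)
      simpa [oddDyadic] using this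
    have hden : (oddDyadic c k).den = 2 ^ (k + 1) := by
      have := Rat.den_div_eq_of_coprime (a := (2 * c + 1 : ℕ)) (b := (2 ^ (k + 1) : ℕ))
          (by positivity) (by simp)
      have h2 := this
      simp [oddDyadic] at h2 ⊢
      exact_mod_cast h2
    rw [encode_rat_eq_length, hnum, hden]
    rfl
  refine Primrec.encode_iff.1 (Primrec.of_eq ?_ fun p => (key p).symm)
  refine Primrec.list_length.comp ((Primrec.listFilter primrecPred_isRatCode).comp
    (Primrec.list_range.comp (Primrec₂.natPair.comp ?_ ?_)))
  · exact Primrec.nat_double.comp (Primrec.nat_double_succ.comp Primrec.fst)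
  · exact primrec_nat_pow.comp (Primrec.const 2) (Primrec.succ.comp Primrec.snd)

/-- The first `k` bits of `X`. -/
def pre (X : ℕ → Bool) (k : ℕ) : List Bool := (List.range k).map X

theorem pre_succ (X : ℕ → Bool) (k : ℕ) : pre X (k + 1) = pre X k ++ [X k] := by
  simp [pre, List.range_succ]

theorem length_pre (X : ℕ → Bool) (k : ℕ) : (pre X k).length = k := by simp [pre]

theorem getElem?_pre (X : ℕ → Bool) (k i : ℕ) :
    (pre X k)[i]? = if i < k then some (X i) else none := by
  by_cases h : i < k <;> simp [pre, h]

theorem pre_prefix_pre (X : ℕ → Bool) {k l : ℕ} (h : k ≤ l) : pre X k <+: pre X l := by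
  induction l, h using Nat.le_induction with
  | base => exact List.prefix_rfl
  | succ l _ ih => rw [pre_succ]; exact ih.trans (List.prefix_append _ _)

/-- `F` is a monotone partial recursive functional on strings which on the initial segments
of `X` computes `f`. -/
def Represents (X : ℕ → Bool) (F : List Bool → ℕ →. ℕ) (f : ℕ →. ℕ) : Prop :=
  Partrec₂ F ∧ (∀ σ τ, σ <+: τ → ∀ n y, y ∈ F σ n → y ∈ F τ n) ∧
    ∀ n y, y ∈ f n ↔ ∃ k, y ∈ F (pre X k) n

theorem represents_of_partrec {X : ℕ → Bool} {f : ℕ →. ℕ} (h : Nat.Partrec f) :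
    Represents X (fun _ n => f n) f :=
  ⟨(Partrec.nat_iff.2 h).comp Computable.snd, fun _ _ _ _ _ h => h, fun _ _ => by simp⟩

theorem mem_bind_pfun {p : Part ℕ} {G : ℕ →. ℕ} {y : ℕ} :
    y ∈ p.bind G ↔ ∃ a ∈ p, y ∈ G a := Part.mem_bind_iff

theorem mem_rfind_eq_zero {G : ℕ → Part ℕ} {y : ℕ} :
    y ∈ Nat.rfind (fun n => (fun m => decide (m = 0)) <$> G n) ↔
      0 ∈ G y ∧ ∀ m < y, ∃ b ∈ G m, b ≠ 0 := by
  refine Nat.mem_rfind.trans (and_congr ?_ ?_)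
  · simp
  · refine forall_congr' fun m => imp_congr_right fun _ => ?_
    simp

theorem indicator_eq_encode (X : ℕ → Bool) (n : ℕ) :
    Set.indicator {n | X n = true} (fun _ => (1 : Part ℕ)) n =
      Part.some (Encodable.encode (X n)) := by
  cases hX : X n <;> simp only [Set.indicator, Set.mem_ofPred_eq, hX] <;> rfl

theorem exists_represents {X : ℕ → Bool} {f : ℕ →. ℕ}
    (h : RecursiveIn {n | X n = true} f) : ∃ F, Represents X F f := by
  induction h with
  | zero => exact ⟨_, represents_of_partrec Nat.Partrec.zero⟩
  | succ => exact ⟨_, represents_of_partrec Nat.Partrec.succ⟩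
  | left => exact ⟨_, represents_of_partrec Nat.Partrec.left⟩
  | right => exact ⟨_, represents_of_partrec Nat.Partrec.right⟩
  | oracle =>
    refine ⟨fun σ n => ((σ[n]?).map Encodable.encode : Option ℕ), ?_, ?_, ?_⟩
    · refine Computable.ofOption (Primrec.to_comp ?_)
      exact Primrec.option_map Primrec.list_getElem? (Primrec.encode.comp Primrec.snd).to₂
    · rintro σ τ ⟨ρ, rfl⟩ n y
      simp only [Part.mem_coe, Option.mem_def, Option.map_eq_some_iff]
      rintro ⟨b, hb, rfl⟩
      refine ⟨b, ?_, rfl⟩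
      rw [List.getElem?_append_left, hb]
      exact (List.getElem?_eq_some_iff.1 hb).1
    · intro n y
      simp only [indicator_eq_encode, Part.mem_some_iff, Part.mem_coe, Option.mem_def,
        getElem?_pre]
      constructor
      · rintro rfl
        exact ⟨n + 1, by simp⟩
      · rintro ⟨k, hk⟩
        by_cases h : n < k <;> simp [h] at hk
        exact hk.symm
  | @pair f g _ _ ihf ihg =>
    obtain ⟨F, hF, mF, rF⟩ := ihf
    obtain ⟨G, hG, mG, rG⟩ := ihg
    refine ⟨fun σ n => Nat.pair <$> F σ n <*> G σ n, ?_, ?_, ?_⟩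
    · have : Partrec fun p : List Bool × ℕ => (F p.1 p.2).bind fun a => (G p.1 p.2).map
        fun b => Nat.pair a b := by
        refine Partrec.bind hF ?_
        refine Partrec.map (hG.comp (Computable.fst.comp Computable.fst)
            (Computable.snd.comp Computable.fst)) ?_
        exact (Primrec₂.natPair.comp (Primrec.snd.comp Primrec.fst) Primrec.snd).to_comp.to₂
      refine Partrec.of_eq this fun p => ?_
      simp [Seq.seq, Part.map_eq_map, Part.bind_map]
    · intro σ τ h n y
      simp only [Seq.seq, Part.map_eq_map, Part.mem_bind_iff, Part.mem_map_iff,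
        exists_exists_and_eq_and]
      rintro ⟨a, ha, b, hb, rfl⟩
      exact ⟨a, mF σ τ h _ _ ha, b, mG σ τ h _ _ hb, rfl⟩
    · intro n y
      simp only [Seq.seq, Part.map_eq_map, Part.mem_bind_iff, Part.mem_map_iff,
        exists_exists_and_eq_and, rF, rG]
      constructor
      · rintro ⟨a, ⟨k, ha⟩, b, ⟨l, hb⟩, rfl⟩
        exact ⟨max k l, a, mF _ _ (pre_prefix_pre X (le_max_left k l)) _ _ ha, b,
          mG _ _ (pre_prefix_pre X (le_max_right k l)) _ _ hb, rfl⟩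
      · rintro ⟨k, a, ha, b, hb, rfl⟩
        exact ⟨a, ⟨k, ha⟩, b, ⟨k, hb⟩, rfl⟩
  | @comp f g _ _ ihf ihg =>
    obtain ⟨F, hF, mF, rF⟩ := ihf
    obtain ⟨G, hG, mG, rG⟩ := ihg
    refine ⟨fun σ n => (G σ n).bind (F σ), ?_, ?_, ?_⟩
    · exact Partrec.bind hG (hF.comp (Computable.fst.comp Computable.fst) Computable.snd)
    · intro σ τ h n y
      simp only [mem_bind_pfun]
      rintro ⟨a, ha, hb⟩
      exact ⟨a, mG σ τ h _ _ ha, mF σ τ h _ _ hb⟩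
    · intro n y
      change y ∈ (g n).bind f ↔ ∃ k, y ∈ (G (pre X k) n).bind (F (pre X k))
      simp only [mem_bind_pfun, rF, rG]
      constructor
      · rintro ⟨a, ⟨k, ha⟩, ⟨l, hb⟩⟩
        exact ⟨max k l, a, mG _ _ (pre_prefix_pre X (le_max_left k l)) _ _ ha,
          mF _ _ (pre_prefix_pre X (le_max_right k l)) _ _ hb⟩
      · rintro ⟨k, a, ha, hb⟩
        exact ⟨a, ⟨k, ha⟩, k, hb⟩
  | @prec f g _ _ ihf ihg =>
    obtain ⟨F, hF, mF, rF⟩ := ihf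
    obtain ⟨G, hG, mG, rG⟩ := ihg
    refine ⟨fun σ => Nat.unpaired fun a n => n.rec (F σ a) fun y IH => IH.bind fun i => G σ
        (Nat.pair a (Nat.pair y i)), ?_, ?_, ?_⟩
    · have : Partrec fun p : List Bool × ℕ => (Nat.rec (F p.1 p.2.unpair.1)
        (fun y IH => IH.bind fun i => G p.1 (Nat.pair p.2.unpair.1
            (Nat.pair y i))) p.2.unpair.2 : Part ℕ) := by
        have u : Computable
            fun p : List Bool × ℕ => p.2.unpair := Computable.unpair.comp Computable.snd
        refine Partrec.nat_rec (Computable.snd.comp u) (hF.comp Computable.fst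
            (Computable.fst.comp u))
          (h := fun p q => G p.1 (Nat.pair p.2.unpair.1 (Nat.pair q.1 q.2))) ?_
        refine hG.comp (Computable.fst.comp Computable.fst) ?_
        refine (Primrec₂.natPair.comp (Primrec.fst.comp (Primrec.unpair.comp
            (Primrec.snd.comp Primrec.fst))) (Primrec₂.natPair.comp
                (Primrec.fst.comp Primrec.snd) (Primrec.snd.comp Primrec.snd))).to_comp
      exact this
    · intro σ τ h n y
      simp only [Nat.unpaired]
      generalize n.unpair.1 = a
      induction n.unpair.2 generalizing y with
      | zero => exact mF σ τ h _ _
      | succ m ih =>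
        simp only [Part.mem_bind_iff]
        rintro ⟨i, hi, hy⟩
        exact ⟨i, ih i hi, mG σ τ h _ _ hy⟩
    · intro n y
      simp only [Nat.unpaired]
      generalize n.unpair.1 = a
      have mono : ∀ σ τ, σ <+: τ → ∀ m y, y ∈ (Nat.rec (F σ a) (fun y IH => IH.bind fun i => G σ
          (Nat.pair a (Nat.pair y i))) m : Part ℕ) → y ∈ (Nat.rec (F τ a) (fun y IH => IH.bind
              fun i => G τ (Nat.pair a (Nat.pair y i))) m : Part ℕ) := by
        intro σ τ h m
        induction m with
        | zero => exact mF σ τ h _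
        | succ m ih =>
          intro y
          simp only [Part.mem_bind_iff]
          rintro ⟨i, hi, hy⟩
          exact ⟨i, ih i hi, mG σ τ h _ _ hy⟩
      induction n.unpair.2 generalizing y with
      | zero => exact rF _ _
      | succ m ih =>
        simp only [Part.bind_eq_bind] at ih
        simp only [Part.bind_eq_bind, Part.mem_bind_iff, ih, rG]
        constructor
        · rintro ⟨a, ⟨k, ha⟩, ⟨l, hb⟩⟩
          exact ⟨max k l, a, mono _ _ (pre_prefix_pre X (le_max_left k l)) _ _ ha,
            mG _ _ (pre_prefix_pre X (le_max_right k l)) _ _ hb⟩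
        · rintro ⟨k, a, ha, hb⟩
          exact ⟨a, ⟨k, ha⟩, k, hb⟩
  | @rfind f _ ihf =>
    obtain ⟨F, hF, mF, rF⟩ := ihf
    refine ⟨fun σ a => Nat.rfind fun n => (fun m => decide (m = 0)) <$> F σ
        (Nat.pair a n), ?_, ?_, ?_⟩
    · refine Partrec.rfind (p := fun (p : List Bool × ℕ) n => (F p.1 (Nat.pair p.2 n)).map
        fun m => decide (m = 0)) ?_
      refine Partrec.map (hF.comp (Computable.fst.comp Computable.fst) (Primrec₂.natPair.comp
          (Primrec.snd.comp Primrec.fst) Primrec.snd).to_comp) ?_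
      exact (primrecPred_iff_primrec_decide.1 (Primrec.eq.comp Primrec.snd
          (Primrec.const 0))).to_comp.to₂
    · intro σ τ h n y
      rw [mem_rfind_eq_zero, mem_rfind_eq_zero]
      rintro ⟨h1, h2⟩
      refine ⟨mF _ _ h _ _ h1, fun m hm => ?_⟩
      obtain ⟨b, hb, h3⟩ := h2 m hm
      exact ⟨b, mF _ _ h _ _ hb, h3⟩
    · intro n y
      simp only [mem_rfind_eq_zero, rF]
      constructor
      · rintro ⟨⟨k, h1⟩, h2⟩
        have : ∀ N ≤ y, ∃ l, ∀ m < N, ∃ b, b ∈ F (pre X l) (Nat.pair n m) ∧ b ≠ 0 := by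
          intro N
          induction N with
          | zero => simp
          | succ N ih =>
            intro hN
            obtain ⟨l, hl⟩ := ih (by lia)
            obtain ⟨b, ⟨l', hb⟩, hb0⟩ := h2 N (by lia)
            refine ⟨max l l', fun m hm => ?_⟩
            rcases Nat.lt_succ_iff_lt_or_eq.1 hm with h | rfl
            · obtain ⟨c, hc, hc0⟩ := hl m h
              exact ⟨c, mF _ _ (pre_prefix_pre X (le_max_left l l')) _ _ hc, hc0⟩
            · exact ⟨b, mF _ _ (pre_prefix_pre X (le_max_right l l')) _ _ hb, hb0⟩
        obtain ⟨l, hl⟩ := this y le_rfl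
        refine ⟨max k l, mF _ _ (pre_prefix_pre X (le_max_left k l)) _ _ h1, fun m hm => ?_⟩
        obtain ⟨c, hc, hc0⟩ := hl _ hm
        exact ⟨c, mF _ _ (pre_prefix_pre X (le_max_right k l)) _ _ hc, hc0⟩
      · rintro ⟨k, h1, h2⟩
        refine ⟨⟨k, h1⟩, fun m hm => ?_⟩
        obtain ⟨b, hb, h3⟩ := h2 m hm
        exact ⟨b, ⟨k, hb⟩, h3⟩

theorem RecursiveIn.of_partrec {A : Set ℕ} {f : ℕ →. ℕ} (h : Nat.Partrec f) : RecursiveIn A f := by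
  induction h with
  | zero => exact .zero
  | succ => exact .succ
  | left => exact .left
  | right => exact .right
  | pair _ _ h1 h2 => exact .pair h1 h2
  | comp _ _ h1 h2 => exact .comp h1 h2
  | prec _ _ h1 h2 => exact .prec h1 h2
  | rfind _ h => exact .rfind h

theorem RecursiveIn.of_eq {A : Set ℕ} {f g : ℕ →. ℕ} (h : RecursiveIn A f)
    (H : ∀ n, f n = g n) : RecursiveIn A g :=
  (funext H : f = g) ▸ h

theorem RecursiveIn.encode_pre (X : ℕ → Bool) :
    RecursiveIn {n | X n = true} (fun k : ℕ => Part.some (Encodable.encode (pre X k))) := by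
  have snoc : Nat.Primrec fun n => Encodable.encode
      (((Encodable.decode (α := List Bool) n.unpair.1).getD []) ++ [decide (n.unpair.2 = 1)]) := by
    refine Primrec.nat_iff.1 (Primrec.encode.comp (Primrec.list_append.comp ?_ ?_))
    · exact Primrec.option_getD.comp (Primrec.decode.comp (Primrec.fst.comp Primrec.unpair))
        (Primrec.const [])
    · exact Primrec.list_cons.comp (primrecPred_iff_primrec_decide.1 (Primrec.eq.comp
        (Primrec.snd.comp Primrec.unpair) (Primrec.const 1))) (Primrec.const [])
  have hi : Nat.Primrec fun n => n.unpair.2.unpair.2 :=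
    Primrec.nat_iff.1 (Primrec.snd.comp (Primrec.unpair.comp (Primrec.snd.comp Primrec.unpair)))
  have hy : Nat.Primrec fun n => n.unpair.2.unpair.1 :=
    Primrec.nat_iff.1 (Primrec.fst.comp (Primrec.unpair.comp (Primrec.snd.comp Primrec.unpair)))
  have step := RecursiveIn.comp (A := {n | X n = true}) (.of_partrec (Nat.Partrec.of_primrec snoc))
    (.pair (.of_partrec (Nat.Partrec.of_primrec hi))
      (.comp .oracle (.of_partrec (Nat.Partrec.of_primrec hy))))
  have hrec := RecursiveIn.prec (A := {n | X n = true})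
    (.of_partrec (Nat.Partrec.of_primrec (Nat.Primrec.const (Encodable.encode
        ([] : List Bool))))) step
  have arg : Nat.Primrec fun n => Nat.pair 0 n :=
    Primrec.nat_iff.1 (Primrec₂.natPair.comp (Primrec.const 0) Primrec.id)
  have := RecursiveIn.comp hrec (.of_partrec (Nat.Partrec.of_primrec arg))
  refine this.of_eq fun k => ?_
  simp only [PFun.coe_val, Part.bind_eq_bind, Part.bind_some, Nat.unpaired, Nat.unpair_pair]
  induction k with
  | zero => rfl
  | succ k ih =>
    simp only [ih, Part.bind_some]
    simp only [indicator_eq_encode]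
    cases hX : X k <;> simp only [Seq.seq, pre_succ, hX] <;> simp <;>
      refine (Part.bind_some _ _).trans ?_ <;> simp

theorem computableIn_of_pre {X : ℕ → Bool} {α σ : Type} [Primcodable α] [Primcodable σ]
    {h : α → List Bool → σ} {K : α → ℕ} (hh : Computable₂ h) (hK : Computable K) :
    ComputableIn {n | X n = true} (fun a => h a (pre X (K a))) := by
  have hK' : Nat.Partrec fun n => Part.bind ↑(Encodable.decode (α := α) n) fun a : α =>
      (Part.some (K a)).map Encodable.encode := hK
  have hh' : Nat.Partrec fun n => Part.bind ↑(Encodable.decode (α := α × List Bool) n)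
      fun a : α × List Bool =>
      (Part.some (h a.1 a.2)).map Encodable.encode := hh
  have := RecursiveIn.comp (A := {n | X n = true}) (.of_partrec hh')
    (.pair (.of_partrec Nat.Partrec.some) (.comp (.encode_pre X) (.of_partrec hK')))
  unfold ComputableIn PartrecIn
  refine this.of_eq fun n => ?_
  cases hd : Encodable.decode (α := α) n with
  | none => simp [Seq.seq]
  | some a =>
    have := Encodable.encodek (pre X (K a))
    simp [Seq.seq, hd]

theorem mem_Cyl_iff_pre {X : ℕ → Bool} {σ : List Bool} : X ∈ Cyl σ ↔ pre X σ.length = σ := by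
  rw [List.ext_getElem_iff]
  simp only [Cyl, Set.mem_ofPred_eq, length_pre, true_and]
  refine forall_congr' fun i => ⟨fun h h1 h2 => ?_, fun h hi => ?_⟩
  · simpa [pre, List.getElem?_eq_getElem h2] using h h2
  · simpa [pre, List.getElem?_eq_getElem hi] using h hi hi

theorem take_pre (X : ℕ → Bool) {i k : ℕ} (h : i ≤ k) : (pre X k).take i = pre X i := by
  have := List.prefix_iff_eq_take.1 (pre_prefix_pre X h)
  rw [length_pre] at this
  exact this.symm

theorem mem_Cyl_iff_prefix_pre {X : ℕ → Bool} {σ : List Bool} {k : ℕ} (h : σ.length ≤ k) :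
    X ∈ Cyl σ ↔ σ <+: pre X k := by
  rw [mem_Cyl_iff_pre, List.prefix_iff_eq_take, take_pre X h, eq_comm]

theorem mem_ClopSet_iff {X : ℕ → Bool} {F : List (List Bool)} :
    X ∈ ClopSet F ↔ ∃ σ ∈ F, X ∈ Cyl σ := by
  simp [ClopSet]

theorem mem_OpenSet_iff {X : ℕ → Bool} {g : ℕ → List (List Bool)} :
    X ∈ OpenSet g ↔ ∃ s, X ∈ ClopSet (g s) := by
  simp [OpenSet]

theorem mem_ClopSet_iff_prefix_pre {X : ℕ → Bool} {F : List (List Bool)} {k : ℕ}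
    (h : ∀ σ ∈ F, σ.length ≤ k) : X ∈ ClopSet F ↔ ∃ σ ∈ F, σ <+: pre X k := by
  rw [mem_ClopSet_iff]
  exact exists_congr fun σ => and_congr_right fun hσ => mem_Cyl_iff_prefix_pre (h σ hσ)

theorem Cyl_eq_pi (σ : List Bool) :
    Cyl σ = Set.pi (Finset.range σ.length) (fun i => {σ.getD i false}) := by
  ext X
  simp [Cyl, Set.mem_pi]

theorem isClopen_Cyl (σ : List Bool) : IsClopen (Cyl σ) := by
  rw [Cyl_eq_pi]
  exact ⟨isClosed_set_pi fun _ _ => isClosed_discrete _,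
    isOpen_set_pi (Finset.finite_toSet _) fun _ _ => isOpen_discrete _⟩

theorem isClopen_ClopSet (F : List (List Bool)) : IsClopen (ClopSet F) := by
  have : ClopSet F = ⋃ σ ∈ F.toFinset, Cyl σ := by simp [ClopSet]
  rw [this]
  exact Set.Finite.isClopen_biUnion (Finset.finite_toSet _) fun σ _ => isClopen_Cyl σ

theorem measurableSet_Cyl (σ : List Bool) : MeasurableSet (Cyl σ) := by
  rw [Cyl_eq_pi]
  exact MeasurableSet.pi (Finset.countable_toSet _) fun _ _ => measurableSet_singleton _

/-- The uniform product measure on Cantor space. -/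
noncomputable def cantorMeasure : Measure (ℕ → Bool) :=
  Measure.infinitePi fun _ => (PMF.uniformOfFintype Bool).toMeasure

instance : IsProbabilityMeasure cantorMeasure := by
  unfold cantorMeasure; infer_instance

theorem cantorMeasure_Cyl (σ : List Bool) : cantorMeasure.real (Cyl σ) = (1 / 2) ^ σ.length := by
  have : ∀ b : Bool, (PMF.uniformOfFintype Bool).toMeasure {b} = 2⁻¹ := fun b => by
    rw [PMF.toMeasure_apply_singleton _ _ (measurableSet_singleton _)]
    simp
  rw [measureReal_def, Cyl_eq_pi, cantorMeasure,
    Measure.infinitePi_pi _ fun i _ => measurableSet_singleton _]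
  simp [this]

theorem cantorMeasure_biUnion_Cyl {S : Finset (List Bool)} {k : ℕ} (hS : ∀ σ ∈ S, σ.length = k) :
    cantorMeasure.real (⋃ σ ∈ S, Cyl σ) = S.card / 2 ^ k := by
  rw [measureReal_biUnion_finset ?_ fun σ _ => measurableSet_Cyl σ,
    Finset.sum_congr rfl fun σ hσ => by rw [cantorMeasure_Cyl, hS σ hσ]]
  · simp [div_eq_mul_inv]
  · intro σ hσ τ hτ hne
    refine Set.disjoint_left.2 fun X h1 h2 => hne ?_
    rw [mem_Cyl_iff_pre] at h1 h2
    rw [hS σ hσ] at h1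
    rw [hS τ hτ] at h2
    exact h1.symm.trans h2

theorem cantorMeasure_ClopSet {F : List (List Bool)} {k : ℕ} (hk : ∀ σ ∈ F, σ.length ≤ k)
    {S : Finset (List Bool)} (hS : ∀ v, v ∈ S ↔ v.length = k ∧ ∃ σ ∈ F, σ <+: v) :
    cantorMeasure.real (ClopSet F) = S.card / 2 ^ k := by
  rw [← cantorMeasure_biUnion_Cyl fun σ hσ => ((hS σ).1 hσ).1]
  congr 1
  ext X
  simp only [mem_ClopSet_iff_prefix_pre hk, Set.mem_iUnion, exists_prop, hS, mem_Cyl_iff_pre]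
  constructor
  · intro h
    exact ⟨pre X k, ⟨length_pre X k, h⟩, by rw [length_pre]⟩
  · rintro ⟨v, ⟨rfl, h⟩, hv⟩
    rwa [hv]

theorem length_le_foldr_max {F : List (List Bool)} {σ : List Bool} (h : σ ∈ F) :
    σ.length ≤ (F.map List.length).foldr max 0 := by
  induction F with
  | nil => simp at h
  | cons τ F ih =>
    simp only [List.map_cons, List.foldr_cons]
    rcases List.mem_cons.1 h with rfl | h
    · exact le_max_left _ _
    · exact (ih h).trans (le_max_right _ _)

theorem listMeasure_eq (F : List (List Bool)) :
    (listMeasure F : ℝ) = cantorMeasure.real (ClopSet F) := by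
  classical
  set k := (F.map List.length).foldr max 0 with hk
  rw [cantorMeasure_ClopSet (fun σ hσ => length_le_foldr_max hσ)
    (S := (Finset.univ.filter fun v : Fin k →
        Bool => ∃ σ ∈ F, σ <+: List.ofFn v).image List.ofFn) ?_]
  · rw [Finset.card_image_of_injective _ List.ofFn_injective]
    simp only [listMeasure]
    push_cast
    congr!
  · intro v
    simp only [Finset.mem_image, Finset.mem_filter, Finset.mem_univ, true_and]
    constructor
    · rintro ⟨w, hw, rfl⟩
      exact ⟨by simp [hk], hw⟩
    · rintro ⟨h1, h2⟩
      refine ⟨fun i => v[i]'(by rw [h1]; exact i.2), ?_, ?_⟩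
      all_goals
        have : List.ofFn (fun i : Fin k => v[i]'(by rw [h1]; exact i.2)) = v := by
          apply List.ext_getElem <;> simp [h1, hk]
      · rwa [this]
      · exact this

theorem ClopSet_flatMap (g : ℕ → List (List Bool)) (L : List ℕ) :
    ClopSet (L.flatMap g) = ⋃ s ∈ L, ClopSet (g s) := by
  ext X
  simp only [mem_ClopSet_iff, List.mem_flatMap, Set.mem_iUnion, exists_prop]
  tauto

theorem openMeasure_eq (g : ℕ → List (List Bool)) :
    openMeasure g = cantorMeasure.real (OpenSet g) := by
  have hmono : Monotone fun s : ℕ => ClopSet ((List.range (s + 1)).flatMap g) := by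
    intro s t h X
    simp only [ClopSet_flatMap, Set.mem_iUnion, List.mem_range, exists_prop]
    rintro ⟨i, hi, hX⟩
    exact ⟨i, by lia, hX⟩
  have hU : OpenSet g = ⋃ s : ℕ, ClopSet ((List.range (s + 1)).flatMap g) := by
    ext X
    simp only [OpenSet, ClopSet_flatMap, Set.mem_iUnion, List.mem_range, exists_prop]
    constructor
    · rintro ⟨s, h⟩; exact ⟨s, s, by lia, h⟩
    · rintro ⟨_, s, _, h⟩; exact ⟨s, h⟩
  simp only [openMeasure, listMeasure_eq]
  rw [hU]
  refine tendsto_nhds_unique (tendsto_atTop_ciSup ?_ ?_)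
    ((ENNReal.tendsto_toReal (measure_ne_top _ _)).comp (tendsto_measure_iUnion_atTop hmono))
  · exact fun s t h => measureReal_mono (hmono h)
  · exact ⟨1, by rintro _ ⟨s, rfl⟩; exact measureReal_le_one⟩

theorem exists_pre_eq {σ : List Bool} : ∃ X, pre X σ.length = σ :=
  ⟨fun i => σ.getD i false, mem_Cyl_iff_pre.1 fun _ _ => rfl⟩

/-- All binary strings of length `k`. -/
def allStrings : ℕ → List (List Bool)
  | 0 => [[]]
  | k + 1 => (allStrings k).flatMap fun v => [false :: v, true :: v]

theorem mem_allStrings {k : ℕ} {v : List Bool} : v ∈ allStrings k ↔ v.length = k := by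
  induction k generalizing v with
  | zero => simp [allStrings]
  | succ k ih =>
    simp only [allStrings, List.mem_flatMap, ih, List.mem_cons, List.not_mem_nil, or_false]
    constructor
    · rintro ⟨w, rfl, rfl | rfl⟩ <;> rfl
    · intro h
      match v, h with
      | b :: w, h =>
        refine ⟨w, by simpa using h, ?_⟩
        cases b <;> simp

theorem nodup_allStrings (k : ℕ) : (allStrings k).Nodup := by
  induction k with
  | zero => simp [allStrings]
  | succ k ih =>
    refine List.nodup_flatMap.2 ⟨fun v _ => by simp, ih.imp fun h => ?_⟩
    simp [Function.onFun, h.symm]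

theorem primrec_allStrings : Primrec allStrings := by
  have : Primrec fun n : ℕ => (Nat.rec [[]] (fun _ L => L.flatMap fun v =>
      [false :: v, true :: v]) n :
      List (List Bool)) := by
    refine Primrec.nat_rec₁ [[]] (f := fun _ (L : List (List Bool)) => L.flatMap fun v =>
        [false :: v, true :: v]) ?_
    refine Primrec.list_flatMap Primrec.snd ?_
    exact Primrec.list_cons.comp (Primrec.list_cons.comp (Primrec.const false) Primrec.snd)
      (Primrec.list_cons.comp (Primrec.list_cons.comp (Primrec.const true) Primrec.snd)
          (Primrec.const []))
  refine this.of_eq fun n => ?_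
  induction n with
  | zero => rfl
  | succ n ih => simp only [allStrings, ← ih]

/-- The number of strings of length `k` extending a member of `F`. -/
def extCount (k : ℕ) (F : List (List Bool)) : ℕ :=
  ((allStrings k).filter fun v => ∃ ρ ∈ F, ρ <+: v).length

theorem extCount_eq {F : List (List Bool)} {k : ℕ} (hk : ∀ σ ∈ F, σ.length ≤ k) :
    cantorMeasure.real (ClopSet F) = extCount k F / 2 ^ k := by
  rw [cantorMeasure_ClopSet hk (S := ((allStrings k).filter fun v => ∃ ρ ∈ F, ρ <+: v).toFinset)]
  · rw [List.toFinset_card_of_nodup ((nodup_allStrings k).filter _), extCount]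
  · intro v
    simp [mem_allStrings]

theorem primrecRel_isPrefix_list : PrimrecRel fun ρ v : List Bool => ρ <+: v := by
  refine PrimrecPred.of_eq (p := fun p : List Bool × List Bool => p.1 = p.2.take p.1.length) ?_
    fun p => List.prefix_iff_eq_take.symm
  exact Primrec.eq.comp Primrec.fst
    (Primrec.list_take.comp (Primrec.list_length.comp Primrec.fst) Primrec.snd)

theorem primrecRel_exists_mem_isPrefix_list :
    PrimrecRel fun (F : List (List Bool)) (v : List Bool) => ∃ ρ ∈ F, ρ <+: v :=
  primrecRel_isPrefix_list.exists_mem_list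

theorem primrec_extCount : Primrec₂ extCount := by
  have hR : PrimrecRel fun (v : List Bool) (F : List (List Bool)) => ∃ ρ ∈ F, ρ <+: v :=
    primrecRel_exists_mem_isPrefix_list.comp Primrec.snd Primrec.fst
  exact Primrec.list_length.comp (hR.listFilter.comp
      (primrec_allStrings.comp Primrec.fst) Primrec.snd)

theorem length_le_length_flatten {F : List (List Bool)} {σ : List Bool} (h : σ ∈ F) :
    σ.length ≤ F.flatten.length :=
  (List.sublist_flatten_of_mem h).length_le

/-- The `Π⁰₁` class of all `X` none of whose initial segments is forbidden by `D`, where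
`D σ c` means that `c` certifies that `σ` is forbidden. -/
def avoidClass (D : List Bool → ℕ → Prop) : Set (ℕ → Bool) := {X | ∀ k c, ¬ D (pre X k) c}

/-- The `t`-th stage of the `(e + 2)`-nd component of the `e`-th candidate for a Schnorr test. -/
def stage (e t : ℕ) : List (List Bool) :=
  (List.range t).flatMap fun s =>
    ((evaln t (Denumerable.ofNat Nat.Partrec.Code e) (Nat.pair (e + 2) s)).bind
      Encodable.decode).getD []

/-- `ClopSet F` has measure at most `2 ^ (-m)`. -/
def IsSmall (F : List (List Bool)) (m : ℕ) : Prop :=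
  extCount F.flatten.length F * 2 ^ m ≤ 2 ^ F.flatten.length

/-- The subsequence of entries of `σ` at odd places. -/
def oddPart (σ : List Bool) : List Bool :=
  (List.range (σ.length / 2)).map fun i => (σ[2 * i + 1]?).getD false

/-- Computation `c` shows that some column of the even part of `σ` disagrees with the
corresponding partial computable function. -/
def Disagrees (σ : List Bool) (c : ℕ) : Prop :=
  let v := evaln c.unpair.2.unpair.2
      (Denumerable.ofNat Nat.Partrec.Code c.unpair.1) c.unpair.2.unpair.1
  let b := σ[2 * Nat.pair c.unpair.1 c.unpair.2.unpair.1]?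
  (b = some false ∧ v = some 1) ∨ (b = some true ∧ v = some 0)

/-- The odd part of `σ` is captured by a small component of a test. -/
def Captured (σ : List Bool) (c : ℕ) : Prop :=
  IsSmall (stage c.unpair.1 c.unpair.2) (c.unpair.1 + 2) ∧
    ∃ ρ ∈ stage c.unpair.1 c.unpair.2, ρ <+: oddPart σ

/-- The forbidden strings for the initial class. -/
def BaseForbidden (σ : List Bool) (c : ℕ) : Prop := Disagrees σ c ∨ Captured σ c

theorem primrec_evaln_ofNat : Primrec fun p : (ℕ × ℕ) × ℕ =>
    evaln p.1.1 (Denumerable.ofNat Nat.Partrec.Code p.1.2) p.2 :=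
  primrec_evaln.comp (Primrec.pair (Primrec.pair (Primrec.fst.comp Primrec.fst)
    ((Primrec.ofNat _).comp (Primrec.snd.comp Primrec.fst))) Primrec.snd)

theorem primrec_stage : Primrec₂ stage := by
  refine Primrec.list_flatMap (Primrec.list_range.comp Primrec.snd) ?_
  refine Primrec.option_getD.comp (Primrec.option_bind ?_ (Primrec.decode.comp Primrec.snd).to₂)
      (Primrec.const [])
  refine primrec_evaln_ofNat.comp (Primrec.pair (Primrec.pair (Primrec.snd.comp Primrec.fst)
    (Primrec.fst.comp Primrec.fst)) (Primrec₂.natPair.comp ?_ Primrec.snd))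
  exact Primrec.succ.comp (Primrec.succ.comp (Primrec.fst.comp Primrec.fst))

theorem primrecRel_isSmall : PrimrecRel IsSmall := by
  have hk : Primrec fun p : List (List Bool) × ℕ => p.1.flatten.length :=
    Primrec.list_length.comp (Primrec.list_flatten.comp Primrec.fst)
  exact Primrec.nat_le.comp
    (Primrec.nat_mul.comp (primrec_extCount.comp hk Primrec.fst)
      (primrec_nat_pow.comp (Primrec.const 2) Primrec.snd))
    (primrec_nat_pow.comp (Primrec.const 2) hk)

theorem primrec_oddPart : Primrec oddPart := by
  refine Primrec.list_map (Primrec.list_range.comp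
    (Primrec.nat_div.comp Primrec.list_length (Primrec.const 2))) ?_
  exact Primrec.option_getD.comp (Primrec.list_getElem?.comp Primrec.fst
    (Primrec.nat_double_succ.comp Primrec.snd)) (Primrec.const false)

theorem primrecRel_baseForbidden : PrimrecRel BaseForbidden := by
  have he : Primrec fun p : List Bool × ℕ => p.2.unpair.1 :=
    Primrec.fst.comp (Primrec.unpair.comp Primrec.snd)
  have ht : Primrec fun p : List Bool × ℕ => p.2.unpair.2 :=
    Primrec.snd.comp (Primrec.unpair.comp Primrec.snd)
  have hv : Primrec fun p : List Bool × ℕ => evaln p.2.unpair.2.unpair.2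
      (Denumerable.ofNat Nat.Partrec.Code p.2.unpair.1) p.2.unpair.2.unpair.1 :=
    primrec_evaln_ofNat.comp (Primrec.pair (Primrec.pair
      (Primrec.snd.comp (Primrec.unpair.comp ht)) he) (Primrec.fst.comp (Primrec.unpair.comp ht)))
  have hb : Primrec
      fun p : List Bool × ℕ => p.1[2 * Nat.pair p.2.unpair.1 p.2.unpair.2.unpair.1]? :=
    Primrec.list_getElem?.comp Primrec.fst (Primrec.nat_double.comp
      (Primrec₂.natPair.comp he (Primrec.fst.comp (Primrec.unpair.comp ht))))
  have hs : Primrec fun p : List Bool × ℕ => stage p.2.unpair.1 p.2.unpair.2 :=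
    primrec_stage.comp he ht
  refine PrimrecPred.or (PrimrecPred.or ?_ ?_) (PrimrecPred.and ?_ ?_)
  · exact PrimrecPred.and (Primrec.eq.comp hb (Primrec.const _)) (Primrec.eq.comp hv
      (Primrec.const _))
  · exact PrimrecPred.and (Primrec.eq.comp hb (Primrec.const _)) (Primrec.eq.comp hv
      (Primrec.const _))
  · exact primrecRel_isSmall.comp hs (Primrec.succ.comp (Primrec.succ.comp he))
  · exact primrecRel_exists_mem_isPrefix_list.comp hs (primrec_oddPart.comp Primrec.fst)

theorem oddPart_pre (X : ℕ → Bool) (k : ℕ) :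
    oddPart (pre X k) = pre (fun i => X (2 * i + 1)) (k / 2) := by
  rw [oddPart, length_pre]
  change _ = (List.range (k / 2)).map _
  refine List.map_congr_left fun i hi => ?_
  rw [getElem?_pre, if_pos (by have := List.mem_range.1 hi; lia), Option.getD_some]

theorem isSmall_iff {F : List (List Bool)} {m : ℕ} :
    IsSmall F m ↔ cantorMeasure.real (ClopSet F) ≤ (1 / 2) ^ m := by
  rw [extCount_eq fun σ h => length_le_length_flatten h, div_le_iff₀ (by positivity), one_div,
    inv_pow, ← div_eq_inv_mul, le_div_iff₀ (by positivity), IsSmall]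
  norm_cast

theorem mem_stage {e t : ℕ} {σ : List Bool} : σ ∈ stage e t ↔
    ∃ s < t, ∃ y ∈ evaln t (Denumerable.ofNat Nat.Partrec.Code e) (Nat.pair (e + 2) s),
      ∃ F : List (List Bool), Encodable.decode y = some F ∧ σ ∈ F := by
  simp only [stage, List.mem_flatMap, List.mem_range]
  refine exists_congr fun s => and_congr_right fun _ => ?_
  cases evaln t (Denumerable.ofNat Nat.Partrec.Code e) (Nat.pair (e + 2) s) with
  | none => simp
  | some y =>
    cases hy : Encodable.decode (α := List (List Bool)) y <;> simp [hy]

theorem ClopSet_mono {F F' : List (List Bool)} (h : F ⊆ F') : ClopSet F ⊆ ClopSet F' := by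
  intro X
  simp only [mem_ClopSet_iff]
  rintro ⟨σ, hσ, hX⟩
  exact ⟨σ, h hσ, hX⟩

theorem stage_mono (e : ℕ) {t t' : ℕ} (h : t ≤ t') : stage e t ⊆ stage e t' := by
  intro σ
  simp only [mem_stage]
  rintro ⟨s, hs, y, hy, hF⟩
  exact ⟨s, by lia, y, evaln_mono h hy, hF⟩

theorem exists_not_captured : ∃ z : ℕ → Bool, ∀ e t,
    IsSmall (stage e t) (e + 2) → z ∉ ClopSet (stage e t) := by
  let V : ℕ → Set (ℕ → Bool) := fun e =>
    ⋃ t : {t // IsSmall (stage e t) (e + 2)}, ClopSet (stage e t)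
  have hV : ∀ e, cantorMeasure (V e) ≤ ENNReal.ofReal ((1 / 2) ^ (e + 2)) := fun e => by
    have hm : Monotone fun t : {t // IsSmall (stage e t) (e + 2)} => ClopSet (stage e t) :=
      fun t t' h => ClopSet_mono (stage_mono e h)
    rw [hm.measure_iUnion]
    refine iSup_le fun t => ?_
    rw [ENNReal.le_ofReal_iff_toReal_le (measure_ne_top _ _) (by positivity)]
    exact isSmall_iff.1 t.2
  have hsum : HasSum (fun e : ℕ => (1 / 2 : ℝ) ^ (e + 2)) (1 / 2) := by
    have h := hasSum_geometric_two.mul_left (1 / 4)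
    rw [show (1 / 4 * 2 : ℝ) = 1 / 2 by norm_num] at h
    exact h.congr_fun fun e => by ring
  have hlt : cantorMeasure (⋃ e, V e) < 1 := by
    refine (measure_iUnion_le V).trans_lt ((ENNReal.tsum_le_tsum hV).trans_lt ?_)
    rw [← ENNReal.ofReal_tsum_of_nonneg (fun _ => by positivity) hsum.summable, hsum.tsum_eq]
    rw [← ENNReal.ofReal_one]
    exact (ENNReal.ofReal_lt_ofReal_iff one_pos).2 (by norm_num)
  have hne : (⋃ e, V e) ≠ Set.univ := by
    intro h
    rw [h, measure_univ] at hlt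
    exact lt_irrefl _ hlt
  obtain ⟨z, hz⟩ := (Set.ne_univ_iff_exists_notMem _).1 hne
  refine ⟨z, fun e t ht hzt => hz ?_⟩
  exact Set.mem_iUnion.2 ⟨e, Set.mem_iUnion.2 ⟨⟨t, ht⟩, hzt⟩⟩

theorem nonempty_avoidClass_baseForbidden : (avoidClass BaseForbidden).Nonempty := by
  classical
  obtain ⟨z, hz⟩ := exists_not_captured
  let X : ℕ → Bool := fun n => if n % 2 = 1 then z (n / 2) else
    decide (1 ∈ eval (Denumerable.ofNat Nat.Partrec.Code (n / 2).unpair.1) (n / 2).unpair.2)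
  have hodd : (fun i => X (2 * i + 1)) = z := by
    funext i
    have h1 : (2 * i + 1) % 2 = 1 := by lia
    have h2 : (2 * i + 1) / 2 = i := by lia
    simp only [X, h1, h2, if_true]
  have heven : ∀ e j, X (2 * Nat.pair e j) = decide (1 ∈ eval
      (Denumerable.ofNat Nat.Partrec.Code e) j) := by
    intro e j
    simp [X]
  refine ⟨X, fun k c => ?_⟩
  rintro (h | ⟨h1, h2⟩)
  · simp only [Disagrees, getElem?_pre] at h
    split_ifs at h
    · simp only [heven, Option.some.injEq, decide_eq_false_iff_not, decide_eq_true_eq] at h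
      rcases h with ⟨h1, h2⟩ | ⟨h1, h2⟩
      · exact h1 (evaln_sound h2)
      · exact absurd (Part.mem_unique h1 (evaln_sound h2)) one_ne_zero
    · simp at h
  · refine hz _ _ h1 ?_
    rw [oddPart_pre, hodd] at h2
    obtain ⟨ρ, hρ, hp⟩ := h2
    refine mem_ClopSet_iff.2 ⟨ρ, hρ, (mem_Cyl_iff_prefix_pre ?_).2 hp⟩
    simpa [length_pre] using hp.length_le

theorem exists_column_eq {X : ℕ → Bool} (hX : X ∈ avoidClass BaseForbidden) {x : ℕ → Bool}
    (hx : Computable x) : ∃ e, ∀ j, x j = X (2 * Nat.pair e j) := by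
  obtain ⟨c, hc⟩ := exists_code.1 (Partrec.nat_iff.1 (Computable.encode.comp hx))
  refine ⟨Encodable.encode c, fun j => ?_⟩
  have hj : Encodable.encode (x j) ∈ eval c j := by rw [hc]; simp
  obtain ⟨t, ht⟩ := evaln_complete.1 hj
  by_contra hne
  refine hX (2 * Nat.pair (Encodable.encode c) j + 1) (Nat.pair (Encodable.encode c) (Nat.pair j t))
    (Or.inl ?_)
  simp only [Disagrees, Nat.unpair_pair, Denumerable.ofNat_encode, getElem?_pre,
    if_pos (Nat.lt_succ_self _)]
  rw [Option.mem_def.1 ht]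
  cases h1 : x j <;> cases h2 : X (2 * Nat.pair (Encodable.encode c) j) <;> simp_all

theorem schnorrRandom_odd {X : ℕ → Bool} (hX : X ∈ avoidClass BaseForbidden) :
    SchnorrRandom fun i => X (2 * i + 1) := by
  rintro N ⟨g, ⟨hg, hle, -⟩, hN⟩ hx
  obtain ⟨c, hc⟩ := exists_code.1 (Partrec.nat_iff.1
    (Computable.encode.comp (hg.comp Computable.unpair)))
  set e := Encodable.encode c with he
  have hc' : ∀ s, Encodable.encode (g (e + 2) s) ∈ eval c (Nat.pair (e + 2) s) := by
    intro s; rw [hc]; simp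
  obtain ⟨s, hs⟩ := mem_OpenSet_iff.1 (Set.mem_iInter.1 (hN hx) (e + 2))
  obtain ⟨ρ, hρ, hxρ⟩ := mem_ClopSet_iff.1 hs
  obtain ⟨t, ht⟩ := evaln_complete.1 (hc' s)
  have hsub : ClopSet (stage e (max t (s + 1))) ⊆ OpenSet (g (e + 2)) := by
    intro Y hY
    obtain ⟨τ, hτ, hYτ⟩ := mem_ClopSet_iff.1 hY
    obtain ⟨s', -, y, hy, F, hF, hτF⟩ := mem_stage.1 hτ
    rw [he, Denumerable.ofNat_encode, ← he] at hy
    have := Part.mem_unique (evaln_sound hy) (hc' s')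
    rw [this, Encodable.encodek] at hF
    cases hF
    exact mem_OpenSet_iff.2 ⟨s', mem_ClopSet_iff.2 ⟨τ, hτF, hYτ⟩⟩
  refine hX (2 * ρ.length) (Nat.pair e (max t (s + 1))) (Or.inr ?_)
  simp only [Captured, Nat.unpair_pair]
  constructor
  · rw [isSmall_iff]
    exact (measureReal_mono hsub).trans ((openMeasure_eq _).symm.le.trans (hle _))
  · refine ⟨ρ, mem_stage.2 ⟨s, by lia, _, ?_, _, Encodable.encodek _, hρ⟩, ?_⟩
    · rw [he, Denumerable.ofNat_encode, ← he]
      exact evaln_mono (le_max_left _ _) ht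
    · rw [oddPart_pre]
      exact (mem_Cyl_iff_prefix_pre (by lia)).1 hxρ

/-- Finite approximations to `avoidClass D`. -/
def avoidApprox (D : List Bool → ℕ → Prop) (t : ℕ) : Set (ℕ → Bool) :=
  {X | ∀ i < t + 1, ∀ c < t + 1, ¬ D (pre X i) c}

theorem avoidApprox_antitone (D : List Bool → ℕ → Prop) : Antitone (avoidApprox D) :=
  fun _ _ h _ hX i hi c hc => hX i (by lia) c (by lia)

theorem iInter_avoidApprox (D : List Bool → ℕ → Prop) : ⋂ t, avoidApprox D t = avoidClass D := by
  ext X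
  simp only [avoidApprox, avoidClass, Set.mem_iInter, Set.mem_ofPred_eq]
  exact ⟨fun h k c => h (max k c) k (by lia) c (by lia), fun h _ k _ c _ => h k c⟩

theorem isClosed_avoidApprox (D : List Bool → ℕ → Prop) (t : ℕ) : IsClosed (avoidApprox D t) := by
  classical
  have : avoidApprox D t = ClopSet ((allStrings t).filter
      fun v => ∀ i < t + 1, ∀ c < t + 1, ¬ D (v.take i) c) := by
    ext X
    rw [mem_ClopSet_iff]
    simp only [List.mem_filter, mem_allStrings, decide_eq_true_eq]
    constructor
    · intro h
      refine ⟨pre X t, ⟨length_pre X t, fun i hi => ?_⟩, ?_⟩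
      · rw [take_pre X (by lia)]
        exact h i hi
      · rw [mem_Cyl_iff_pre, length_pre]
    · rintro ⟨v, ⟨rfl, h⟩, hX⟩ i hi
      rw [mem_Cyl_iff_pre] at hX
      have := h i hi
      rwa [← hX, take_pre X (by lia), length_pre] at this
  rw [this]
  exact (isClopen_ClopSet _).isClosed

theorem isClosed_avoidClass (D : List Bool → ℕ → Prop) : IsClosed (avoidClass D) := by
  rw [← iInter_avoidApprox]
  exact isClosed_iInter (isClosed_avoidApprox D)

theorem exists_forall_allStrings {D : List Bool → ℕ → Prop} (h : ¬ (avoidClass D).Nonempty) :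
    ∃ t, ∀ v ∈ allStrings t, ∃ i < t + 1, ∃ c < t + 1, D (v.take i) c := by
  by_contra! hc
  refine h ?_
  rw [← iInter_avoidApprox]
  refine IsCompact.nonempty_iInter_of_sequence_nonempty_isCompact_isClosed _
    (fun t => avoidApprox_antitone D (Nat.le_succ t)) (fun t => ?_)
    (isClosed_avoidApprox D 0).isCompact (isClosed_avoidApprox D)
  obtain ⟨v, hv, hv'⟩ := hc t
  obtain ⟨X, hX⟩ := exists_pre_eq (σ := v)
  rw [mem_allStrings.1 hv] at hX
  refine ⟨X, fun i hi c hc => ?_⟩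
  have := hv' i hi c hc
  rwa [← hX, take_pre X (by lia)] at this

theorem computable_find {Q : ℕ → ℕ → Prop} [DecidableRel Q] (hQ : PrimrecRel Q)
    (h : ∀ n, ∃ t, Q n t) : Computable fun n => Nat.find (h n) := by
  have h1 : Partrec₂ fun n t : ℕ => Part.some (decide (Q n t)) :=
    (primrecPred_iff_primrec_decide.1 hQ).to_comp.partrec
  refine (Partrec.rfind h1).of_eq fun n => ?_
  refine Part.eq_some_iff.2 (Nat.mem_rfind.2 ⟨?_, fun {m} hm => ?_⟩)
  · simpa using Nat.find_spec (h n)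
  · simpa using Nat.find_min (h n) hm

theorem primrecRel_exists_lt {β : Type*} [Primcodable β] {R : ℕ → β → Prop} (hR : PrimrecRel R) :
    PrimrecRel fun (N : ℕ) (b : β) => ∃ n < N, R n b :=
  (PrimrecRel.comp (R := fun (L : List ℕ) (b : β) => ∃ n ∈ L, R n b) hR.exists_mem_list
    (Primrec.list_range.comp Primrec.fst) Primrec.snd).of_eq (by simp)

/-- The functional with code `c` diverges on oracle `X` and some input. -/
def Diverges (c : Nat.Partrec.Code) (X : ℕ → Bool) : Prop :=
  ∃ n : ℕ, ∀ k y, y ∉ eval c (Encodable.encode (pre X k, n))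

/-- The functional with code `c` takes values on oracle `X` that are computably bounded. -/
def CompBounded (c : Nat.Partrec.Code) (X : ℕ → Bool) : Prop :=
  ∃ g : ℕ → ℕ, Computable g ∧ ∀ n : ℕ, ∃ k, ∃ y ≤ g n, y ∈ eval c (Encodable.encode (pre X k, n))

theorem exists_primrecRel_decides {D : List Bool → ℕ → Prop} (hD : PrimrecRel D)
    (hne : (avoidClass D).Nonempty) (c : Nat.Partrec.Code) :
    ∃ D', PrimrecRel D' ∧ (avoidClass D').Nonempty ∧ avoidClass D' ⊆ avoidClass D ∧
      ∀ X ∈ avoidClass D', Diverges c X ∨ CompBounded c X := by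
  classical
  let w : ℕ → List Bool → ℕ → Option ℕ := fun n σ t => evaln t c (Encodable.encode (σ, n))
  let E : ℕ → List Bool → ℕ → Prop := fun n σ t => D σ t ∨ (w n σ t ≠ none ∧ (w n σ t).getD 0 ≤ t)
  have hE : PrimrecPred fun p : (ℕ × List Bool) × ℕ => E p.1.1 p.1.2 p.2 := by
    have hw : Primrec fun p : (ℕ × List Bool) × ℕ => w p.1.1 p.1.2 p.2 :=
      primrec_evaln.comp (Primrec.pair (Primrec.pair Primrec.snd (Primrec.const c))
        (Primrec.encode.comp (Primrec.pair (Primrec.snd.comp Primrec.fst)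
          (Primrec.fst.comp Primrec.fst))))
    refine PrimrecPred.or (hD.comp (Primrec.snd.comp Primrec.fst) Primrec.snd)
      (PrimrecPred.and (PrimrecPred.not (Primrec.eq.comp hw (Primrec.const none))) ?_)
    exact Primrec.nat_le.comp (Primrec.option_getD.comp hw (Primrec.const 0)) Primrec.snd
  by_cases hcase : ∃ n, (avoidClass (E n)).Nonempty
  · obtain ⟨n, hn⟩ := hcase
    refine ⟨E n, hE.comp (Primrec.pair (Primrec.pair (Primrec.const n) Primrec.fst) Primrec.snd),
      hn, fun X hX k t hk => hX k t (Or.inl hk), fun X hX => Or.inl ⟨n, fun k y hy => ?_⟩⟩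
    obtain ⟨t, ht⟩ := evaln_complete.1 hy
    have hw : w n (pre X k) (max t y) = some y := evaln_mono (le_max_left _ _) ht
    exact hX k (max t y) (Or.inr (by simp [hw]))
  · push Not at hcase
    let Q : ℕ → ℕ → Prop := fun n t =>
      ∀ v ∈ allStrings t, ∃ i < t + 1, ∃ s < t + 1, E n (v.take i) s
    have hQ : PrimrecRel Q := by
      have h1 : PrimrecRel fun (s : ℕ) (q : (ℕ × List Bool) × ℕ) =>
          E q.1.1 (q.1.2.take q.2) s := by
        refine hE.comp (Primrec.pair (Primrec.pair
          (Primrec.fst.comp (Primrec.fst.comp Primrec.snd)) ?_) Primrec.fst)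
        exact Primrec.list_take.comp (Primrec.snd.comp Primrec.snd)
          (Primrec.snd.comp (Primrec.fst.comp Primrec.snd))
      have h2 : PrimrecRel fun (i : ℕ) (p : (ℕ × ℕ) × List Bool) =>
          ∃ s < p.1.2 + 1, E p.1.1 (p.2.take i) s :=
        PrimrecRel.comp (R := fun (N : ℕ) (q : (ℕ × List Bool) × ℕ) => ∃ s < N, E q.1.1
            (q.1.2.take q.2) s)
          (primrecRel_exists_lt h1) (f := fun q : ℕ × ((ℕ × ℕ) × List Bool) => q.2.1.2 + 1)
          (g := fun q => ((q.2.1.1, q.2.2), q.1))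
          (Primrec.succ.comp (Primrec.snd.comp (Primrec.fst.comp Primrec.snd)))
          (Primrec.pair (Primrec.pair (Primrec.fst.comp (Primrec.fst.comp Primrec.snd))
            (Primrec.snd.comp Primrec.snd)) Primrec.fst)
      have h3 : PrimrecRel fun (v : List Bool) (p : ℕ × ℕ) =>
          ∃ i < p.2 + 1, ∃ s < p.2 + 1, E p.1 (v.take i) s :=
        PrimrecRel.comp (R := fun (N : ℕ) (p : (ℕ × ℕ) × List Bool) =>
            ∃ i < N, ∃ s < p.1.2 + 1, E p.1.1 (p.2.take i) s) (primrecRel_exists_lt h2) (f :=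
                fun q : List Bool × (ℕ × ℕ) => q.2.2 + 1)
          (g := fun q => (q.2, q.1))
          (Primrec.succ.comp (Primrec.snd.comp Primrec.snd))
          (Primrec.pair Primrec.snd Primrec.fst)
      exact PrimrecRel.comp (R := fun (L : List (List Bool)) (p : ℕ × ℕ) =>
          ∀ v ∈ L, ∃ i < p.2 + 1, ∃ s < p.2 + 1, E p.1 (v.take i) s) h3.forall_mem_list (f :=
              fun p : ℕ × ℕ => allStrings p.2) (g := fun p => p)
        (primrec_allStrings.comp Primrec.snd) Primrec.id
    have hex : ∀ n, ∃ t, Q n t := fun n =>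
      exists_forall_allStrings (Set.not_nonempty_iff_eq_empty.2 (hcase n))
    refine ⟨D, hD, hne, subset_rfl, fun X hX => Or.inr ⟨_, computable_find hQ hex, fun n => ?_⟩⟩
    obtain ⟨i, hi, s, hs, h⟩ := Nat.find_spec (hex n) (pre X (Nat.find (hex n)))
      (mem_allStrings.2 (length_pre _ _))
    rw [take_pre X (by lia)] at h
    rcases h with h | ⟨h1, h2⟩
    · exact absurd h (hX i s)
    · obtain ⟨y, hy⟩ := Option.ne_none_iff_exists'.1 h1
      rw [hy, Option.getD_some] at h2
      exact ⟨i, y, by lia, evaln_sound hy⟩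

theorem exists_mem_avoidClass_decides {D : List Bool → ℕ → Prop} (hD : PrimrecRel D)
    (hne : (avoidClass D).Nonempty) :
    ∃ X ∈ avoidClass D, ∀ c, Diverges c X ∨ CompBounded c X := by
  choose! next hn1 hn2 hn3 hn4 using fun (D : List Bool → ℕ → Prop)
    (h : PrimrecRel D ∧ (avoidClass D).Nonempty) => exists_primrecRel_decides h.1 h.2
  let S : ℕ → List Bool → ℕ → Prop := fun m =>
    Nat.rec D (fun e D' => next D' (Denumerable.ofNat Nat.Partrec.Code e)) m
  have hS : ∀ m, PrimrecRel (S m) ∧ (avoidClass (S m)).Nonempty := by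
    intro m
    induction m with
    | zero => exact ⟨hD, hne⟩
    | succ m ih => exact ⟨hn1 _ ih _, hn2 _ ih _⟩
  obtain ⟨X, hX⟩ := IsCompact.nonempty_iInter_of_sequence_nonempty_isCompact_isClosed
    (fun m => avoidClass (S m)) (fun m => hn3 _ (hS m) _) (fun m => (hS m).2)
    (isClosed_avoidClass _).isCompact (fun m => isClosed_avoidClass _)
  rw [Set.mem_iInter] at hX
  refine ⟨X, hX 0, fun c => ?_⟩
  have := hn4 _ (hS (Encodable.encode c)) (Denumerable.ofNat Nat.Partrec.Code
      (Encodable.encode c)) X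
    (hX (Encodable.encode c + 1))
  rwa [Denumerable.ofNat_encode] at this

theorem hyperimmuneFree_of_decides {X : ℕ → Bool} (hX : ∀ c, Diverges c X ∨ CompBounded c X) :
    HyperimmuneFree {n | X n = true} := by
  intro f hf
  have hf' : RecursiveIn {n | X n = true} fun n => Part.some (f n) :=
    RecursiveIn.of_eq hf fun n => by simp
  obtain ⟨F, hF, -, hFf⟩ := exists_represents hf'
  obtain ⟨c, hc⟩ := exists_code.1 hF
  have key : ∀ σ n y, y ∈ eval c (Encodable.encode (σ, n)) ↔ y ∈ F σ n := by
    intro σ n y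
    rw [hc]
    simp
  rcases hX c with ⟨n, hn⟩ | ⟨g, hg, hb⟩
  · obtain ⟨k, hk⟩ := (hFf n (f n)).1 (Part.mem_some _)
    exact absurd ((key _ _ _).2 hk) (hn k _)
  · refine ⟨g, hg, Eventually.of_forall fun n => ?_⟩
    obtain ⟨k, y, hy, hk⟩ := hb n
    have := (hFf n y).2 ⟨k, (key _ _ _).1 hk⟩
    rwa [Part.mem_some_iff.1 this] at hy

theorem cantorMeasure_iUnion_Cyl_le {τ : ℕ → List Bool} {m : ℕ}
    (hτ : ∀ s, (τ s).length = s + m + 1) : cantorMeasure.real (⋃ s, Cyl (τ s)) ≤ (1 / 2) ^ m := by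
  have hsum : HasSum (fun s : ℕ => (1 / 2 : ℝ) ^ (s + m + 1)) ((1 / 2) ^ m) := by
    have h := hasSum_geometric_two.mul_left ((1 / 2) ^ (m + 1))
    rw [show ((1 / 2) ^ (m + 1) * 2 : ℝ) = (1 / 2) ^ m by ring] at h
    exact h.congr_fun fun s => by ring
  refine ENNReal.toReal_le_of_le_ofReal (by positivity) ?_
  refine (measure_iUnion_le _).trans ?_
  rw [← hsum.tsum_eq, ENNReal.ofReal_tsum_of_nonneg (fun _ => by positivity) hsum.summable]
  refine ENNReal.tsum_le_tsum fun s => ?_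
  rw [← hτ s, ← cantorMeasure_Cyl, ofReal_measureReal]

/-- The first `L` entries of the `s`-th column of the even part of `σ`. -/
def columnPre (σ : List Bool) (s L : ℕ) : List Bool :=
  (List.range L).map fun j => (σ[2 * Nat.pair s j]?).getD false

theorem primrec_columnPre : Primrec fun p : List Bool × ℕ × ℕ => columnPre p.1 p.2.1 p.2.2 := by
  refine Primrec.list_map (Primrec.list_range.comp (Primrec.snd.comp Primrec.snd)) ?_
  refine Primrec.option_getD.comp (Primrec.list_getElem?.comp (Primrec.fst.comp Primrec.fst)
    (Primrec.nat_double.comp (Primrec₂.natPair.comp ?_ Primrec.snd))) (Primrec.const false)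
  exact Primrec.fst.comp (Primrec.snd.comp Primrec.fst)

theorem columnPre_pre {X : ℕ → Bool} {K s L : ℕ} (h : ∀ j < L, 2 * Nat.pair s j < K) :
    columnPre (pre X K) s L = pre (fun j => X (2 * Nat.pair s j)) L := by
  change _ = (List.range L).map _
  refine List.map_congr_left fun j hj => ?_
  rw [getElem?_pre, if_pos (h j (List.mem_range.1 hj)), Option.getD_some]

theorem weaklySchnorrEngulfing_of_columns {X : ℕ → Bool}
    (hX : ∀ x : ℕ → Bool, Computable x → ∃ e, ∀ j, x j = X (2 * Nat.pair e j)) :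
    WeaklySchnorrEngulfing {n | X n = true} := by
  let τ : ℕ → ℕ → List Bool := fun m s => pre (fun j => X (2 * Nat.pair s j)) (s + m + 1)
  have hτ : ∀ m s, (τ m s).length = s + m + 1 := fun m s => length_pre _ _
  have hopen : ∀ m, OpenSet (fun s => [τ m s]) = ⋃ s, Cyl (τ m s) := by
    intro m; ext Y; simp [mem_OpenSet_iff, mem_ClopSet_iff]
  refine ⟨⋂ m, OpenSet fun s => [τ m s], ⟨fun m s => [τ m s], ⟨?_, fun m => ?_, ?_⟩, subset_rfl⟩,
    fun x hx => ?_⟩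
  · have hc : Computable₂ fun (p : ℕ × ℕ) (σ : List Bool) => [columnPre σ p.2 (p.2 + p.1 + 1)] := by
      refine Primrec.to_comp (Primrec.list_cons.comp (primrec_columnPre.comp
          (Primrec.pair Primrec.snd
        (Primrec.pair (Primrec.snd.comp Primrec.fst) ?_))) (Primrec.const []))
      exact Primrec.succ.comp (Primrec.nat_add.comp (Primrec.snd.comp Primrec.fst)
        (Primrec.fst.comp Primrec.fst))
    have hK : Computable fun p : ℕ × ℕ => 2 * Nat.pair p.2 (p.2 + p.1 + 1) := by
      refine Primrec.to_comp (Primrec.nat_double.comp (Primrec₂.natPair.comp Primrec.snd ?_))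
      exact Primrec.succ.comp (Primrec.nat_add.comp Primrec.snd Primrec.fst)
    have := computableIn_of_pre (X := X) hc hK
    convert this using 4 with p
    refine (columnPre_pre fun j hj => ?_).symm
    have := Nat.pair_lt_pair_right p.2 hj
    lia
  · rw [openMeasure_eq, hopen]
    exact cantorMeasure_iUnion_Cyl_le (hτ m)
  · let F : ℕ × ℕ → List Bool → List (List Bool) := fun p σ =>
      (List.range (p.2 + 1)).map fun s => columnPre σ s (s + p.1 + 1)
    let lev : ℕ × ℕ → List Bool → ℕ := fun p σ => (F p σ).flatten.length + p.2
    have hF : Primrec₂ F := by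
      refine Primrec.list_map (Primrec.list_range.comp
        (Primrec.succ.comp (Primrec.snd.comp Primrec.fst))) ?_
      refine primrec_columnPre.comp (Primrec.pair (Primrec.snd.comp Primrec.fst)
        (Primrec.pair Primrec.snd (Primrec.succ.comp (Primrec.nat_add.comp Primrec.snd ?_))))
      exact Primrec.fst.comp (Primrec.fst.comp Primrec.fst)
    have hlev : Primrec₂ lev := Primrec.nat_add.comp (Primrec.list_length.comp
      (Primrec.list_flatten.comp hF)) (Primrec.snd.comp Primrec.fst)
    have hq : Primrec₂ fun p σ => oddDyadic (extCount (lev p σ) (F p σ)) (lev p σ) :=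
      primrec_oddDyadic.comp (primrec_extCount.comp hlev hF) hlev
    have hK : Computable fun p : ℕ × ℕ => 2 * Nat.pair (p.2 + 1) (p.2 + p.1 + 1) := by
      refine Primrec.to_comp (Primrec.nat_double.comp
        (Primrec₂.natPair.comp (Primrec.succ.comp Primrec.snd) ?_))
      exact Primrec.succ.comp (Primrec.nat_add.comp Primrec.snd Primrec.fst)
    refine ⟨_, computableIn_of_pre (X := X) hq.to_comp hK, fun m k => ?_⟩
    have hFX : F (m, k) (pre X (2 * Nat.pair (k + 1) (k + m + 1))) =
        (List.range (k + 1)).map (τ m) := by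
      refine List.map_congr_left fun s hs => columnPre_pre fun j hj => ?_
      have hs := List.mem_range.1 hs
      have h1 := Nat.pair_lt_pair_left j hs
      have h2 := Nat.pair_lt_pair_right (k + 1) (show j < k + m + 1 by lia)
      lia
    simp only [lev, hFX]
    set G := (List.range (k + 1)).map (τ m) with hG
    set K := G.flatten.length + k with hK'
    have hmeas : cantorMeasure.real (ClopSet G) = extCount K G / 2 ^ K :=
      extCount_eq fun σ h => (length_le_length_flatten h).trans (Nat.le_add_right _ _)
    have hlow : ClopSet G ⊆ OpenSet fun s => [τ m s] := by
      intro Y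
      simp only [hopen, mem_ClopSet_iff, hG, List.mem_map, Set.mem_iUnion]
      rintro ⟨_, ⟨s, -, rfl⟩, h⟩
      exact ⟨s, h⟩
    have hup : (OpenSet fun s => [τ m s]) ⊆ ClopSet G ∪ ⋃ s, Cyl (τ m (s + (k + 1))) := by
      intro Y
      simp only [hopen, mem_ClopSet_iff, hG, List.mem_map, List.mem_range, Set.mem_iUnion,
        Set.mem_union]
      rintro ⟨s, h⟩
      by_cases hs : s < k + 1
      · exact Or.inl ⟨_, ⟨s, hs, rfl⟩, h⟩
      · refine Or.inr ⟨s - (k + 1), ?_⟩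
        rwa [Nat.sub_add_cancel (by lia)]
    have h1 := measureReal_mono (μ := cantorMeasure) hlow
    have h2 := (measureReal_mono (μ := cantorMeasure) hup).trans (measureReal_union_le _ _)
    have h3 := cantorMeasure_iUnion_Cyl_le (τ := fun s => τ m (s + (k + 1))) (m := m + (k + 1))
      fun s => by rw [hτ]; lia
    have h4 : (1 / 2 : ℝ) ^ (m + (k + 1)) ≤ (1 / 2) ^ k :=
      pow_le_pow_of_le_one (by norm_num) (by norm_num) (by lia)
    have h5 : (1 / 2 : ℝ) ^ (K + 1) ≤ (1 / 2) ^ k :=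
      pow_le_pow_of_le_one (by norm_num) (by norm_num) (by lia)
    have h6 : ((oddDyadic (extCount K G) K : ℚ) : ℝ) =
        cantorMeasure.real (ClopSet G) + (1 / 2) ^ (K + 1) := by
      rw [hmeas, oddDyadic]
      push_cast
      rw [one_div, inv_pow, pow_succ]
      field_simp
    have h7 : (0 : ℝ) ≤ (1 / 2) ^ (K + 1) := by positivity
    rw [openMeasure_eq, h6, abs_le]
    constructor <;> linarith
  · obtain ⟨e, he⟩ := hX x hx
    refine Set.mem_iInter.2 fun m => ?_
    rw [hopen]
    refine Set.mem_iUnion.2 ⟨e, mem_Cyl_iff_pre.2 ?_⟩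
    rw [hτ, funext he]

theorem computableIn_odd (X : ℕ → Bool) : ComputableIn {n | X n = true} fun i => X (2 * i + 1) := by
  have hc : Computable₂ fun (i : ℕ) (σ : List Bool) => (σ[2 * i + 1]?).getD false :=
    Primrec.to_comp (Primrec.option_getD.comp (Primrec.list_getElem?.comp Primrec.snd
      (Primrec.nat_double_succ.comp Primrec.fst)) (Primrec.const false))
  have hK : Computable fun i : ℕ => 2 * i + 1 + 1 :=
    (Primrec.succ.comp Primrec.nat_double_succ).to_comp
  have := computableIn_of_pre (X := X) hc hK
  simpa [getElem?_pre] using this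

end

/-- there is an oracle of hyperimmune-free degree that is weakly Schnorr
engulfing and computes a Schnorr random element of Cantor space. -/
theorem stmt16 :
    ∃ A : Set ℕ, HyperimmuneFree A ∧ WeaklySchnorrEngulfing A ∧
      ∃ x : ℕ → Bool, ComputableIn A x ∧ SchnorrRandom x := by
  obtain ⟨X, hX, hdec⟩ :=
    exists_mem_avoidClass_decides primrecRel_baseForbidden nonempty_avoidClass_baseForbidden
  exact ⟨{n | X n = true}, hyperimmuneFree_of_decides hdec,
    weaklySchnorrEngulfing_of_columns fun x hx => exists_column_eq hX hx,
    _, computableIn_odd X, schnorrRandom_odd hX⟩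

end CichonAnalog
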